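/- arXiv:1810.05803 — 3 statements merged into one kernel-verified Lean document; each statement's English description precedes it below -/
import Mathlib

section
/- Let p be a prime, let m ≥ 3 be an integer, and let N ≥ 1. For all N×N matrices A, B, X over ℤ/p^mℤ, the identity (1 + p^{m-2}·X) · (1 + p·A + p²·B) · (1 − p^{m-2}·X + p^{2m-4}·X²) = (1 + p^{m-1}·(X·A − A·X)) · (1 + p·A + p²·B) holds in the matrix ring M_N(ℤ/p^mℤ). -/
/-- Conjugation of `1 + tA + t²B` by `1 + tsX`, when `t³s = 0`. -/
theorem conj_one_add_smul_of_pow_three_mul_eq_zero {R S : Type*} [CommRing R] [Ring S]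
    [Algebra R S] {t s : R} (h : t ^ 3 * s = 0) (A B X : S) :
    (1 + (t * s) • X) * (1 + t • A + t ^ 2 • B) *
        (1 - (t * s) • X + (t * s) ^ 2 • X ^ 2) =
      (1 + (t ^ 2 * s) • (X * A - A * X)) * (1 + t • A + t ^ 2 • B) := by
  have h_inv : (1 + (t * s) • X) * (1 - (t * s) • X + (t * s) ^ 2 • X ^ 2) = 1 := by
    have h_diff : (1 + (t * s) • X) * (1 - (t * s) • X + (t * s) ^ 2 • X ^ 2) - 1 =
        (t ^ 3 * s) • (s ^ 2 • X ^ 3) := by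
      simp only [pow_succ X, pow_zero, one_mul, mul_add, add_mul, mul_sub, mul_one,
        smul_mul_assoc, mul_smul_comm, mul_assoc]
      module
    rwa [h, zero_smul, sub_eq_zero] at h_diff
  have h_comm : (1 + (t * s) • X) * (1 + t • A + t ^ 2 • B) =
      (1 + (t ^ 2 * s) • (X * A - A * X)) * (1 + t • A + t ^ 2 • B) * (1 + (t * s) • X) := by
    have h_diff : (1 + (t * s) • X) * (1 + t • A + t ^ 2 • B) -
        (1 + (t ^ 2 * s) • (X * A - A * X)) * (1 + t • A + t ^ 2 • B) * (1 + (t * s) • X) =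
        (t ^ 3 * s) • (X * B - B * X - (X * A - A * X) * (A + t • B) -
          s • ((X * A - A * X) * (1 + t • A + t ^ 2 • B) * X)) := by
      simp only [one_mul, mul_add, add_mul, sub_mul, mul_one,
        smul_mul_assoc, mul_smul_comm, mul_assoc]
      module
    rwa [h, zero_smul, sub_eq_zero] at h_diff
  rw [h_comm, mul_assoc, h_inv, mul_one]

/-- The basic matrix identity (Equation (1)) underlying the construction of extra
stabilizing cocycles at trivial primes: for `m ≥ 3` and all `N × N` matrices
`A, B, X` over `ℤ/p^mℤ`,
`(1 + p^{m-2}X)(1 + pA + p²B)(1 - p^{m-2}X + p^{2m-4}X²)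
  = (1 + p^{m-1}(XA - AX))(1 + pA + p²B)`. -/
theorem matrix_identity_mod_p_pow
    (p : ℕ) (hp : p.Prime) (m N : ℕ) (hm : 3 ≤ m) (hN : 1 ≤ N)
    (A B X : Matrix (Fin N) (Fin N) (ZMod (p ^ m))) :
    (1 + (p : ZMod (p ^ m)) ^ (m - 2) • X) *
        (1 + (p : ZMod (p ^ m)) • A + (p : ZMod (p ^ m)) ^ 2 • B) *
        (1 - (p : ZMod (p ^ m)) ^ (m - 2) • X +
          (p : ZMod (p ^ m)) ^ (2 * m - 4) • X ^ 2) =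
      (1 + (p : ZMod (p ^ m)) ^ (m - 1) • (X * A - A * X)) *
        (1 + (p : ZMod (p ^ m)) • A + (p : ZMod (p ^ m)) ^ 2 • B) := by
  obtain ⟨k, rfl⟩ := Nat.exists_eq_add_of_le' hm
  have h : (p : ZMod (p ^ (k + 3))) ^ 3 * (p : ZMod (p ^ (k + 3))) ^ k = 0 := by
    rw [← pow_add, add_comm 3 k, ← Nat.cast_pow, ZMod.natCast_self]
  rw [show k + 3 - 2 = 1 + k by omega, show k + 3 - 1 = 2 + k by omega,
    show 2 * (k + 3) - 4 = (1 + k) * 2 by omega, pow_mul, pow_add _ 1 k, pow_add _ 2 k, pow_one]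
  exact conj_one_add_smul_of_pow_three_mul_eq_zero h A B X
end

section
/- Let p be a prime, let m ≥ 3 be an integer, and let N ≥ 1. Let ρ be an invertible N×N matrix over ℤ/p^mℤ and let X be an N×N matrix over ℤ/p^mℤ such that ρ·X·ρ⁻¹ − X lies in p·M_N(ℤ/p^mℤ). Then 1 + p^{m-2}·X is invertible in M_N(ℤ/p^mℤ) with inverse 1 − p^{m-2}·X + p^{2m-4}·X², and (1 + p^{m-2}·X) · ρ · (1 + p^{m-2}·X)⁻¹ = (1 + p^{m-2}·(X − ρ·X·ρ⁻¹)) · ρ. -/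
section Algebra

variable {R A : Type*} [CommRing R] [Ring A] [Algebra R A]

theorem one_add_smul_mul_of_pow_three_eq_zero {a : R} (ha : a ^ 3 = 0) (X : A) :
    (1 + a • X) * (1 - a • X + a ^ 2 • X ^ 2) = 1 := by
  have h : (a • X) ^ 3 = 0 := by rw [smul_pow, ha, zero_smul]
  rw [← smul_pow]
  generalize a • X = t at h ⊢
  calc
    _ = 1 + t ^ 3 := by noncomm_ring
    _ = 1 := by rw [h, add_zero]

theorem mul_one_add_smul_of_pow_three_eq_zero {a : R} (ha : a ^ 3 = 0) (X : A) :
    (1 - a • X + a ^ 2 • X ^ 2) * (1 + a • X) = 1 := by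
  have h : (a • X) ^ 3 = 0 := by rw [smul_pow, ha, zero_smul]
  rw [← smul_pow]
  generalize a • X = t at h ⊢
  calc
    _ = 1 + t ^ 3 := by noncomm_ring
    _ = 1 := by rw [h, add_zero]

/-- If `X` and its conjugate by `u` agree after multiplication by `a ^ 2`, then conjugating `u` by
`1 + a • X` is the same as multiplying it by `1 + a • (X - u * X * u⁻¹)`. -/
theorem one_add_smul_conj_unit {a : R} (ha : a ^ 3 = 0) (u : Aˣ) (X : A)
    (hX : a ^ 2 • (u * X * ↑u⁻¹ - X : A) = 0) :
    (1 + a • X) * u * (1 - a • X + a ^ 2 • X ^ 2) =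
      (1 + a • (X - u * X * ↑u⁻¹)) * u := by
  set Z : A := u * X * ↑u⁻¹ with hZ
  have hu : (u : A) * X = Z * u := by simp [hZ]
  have hXZ : a ^ 2 • (X * Z) = a ^ 2 • (Z * Z) := by
    rw [smul_sub, sub_eq_zero] at hX
    rw [← smul_mul_assoc, ← hX, smul_mul_assoc]
  have key : (1 + a • X) * u = (1 + a • (X - Z)) * u * (1 + a • X) := by
    have hcomm : (u : A) * (1 + a • X) = (1 + a • Z) * u := by
      rw [mul_add, add_mul, mul_one, one_mul, mul_smul_comm, smul_mul_assoc, hu]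
    rw [mul_assoc, hcomm, ← mul_assoc]
    congr 1
    simp only [add_mul, mul_add, one_mul, mul_one, sub_mul, smul_sub, smul_add, smul_mul_assoc,
      mul_smul_comm, smul_smul, ← pow_two a, hXZ]
    abel
  rw [key, mul_assoc _ (1 + a • X), one_add_smul_mul_of_pow_three_eq_zero ha, mul_one]

end Algebra

/-- The conjugation identity at the computational core of the construction of extra
cocycles preserving ordinary lifting sets: if `ρ` is an invertible `N × N` matrix over
`ℤ/p^mℤ` (`m ≥ 3`) and `X` is a matrix with `ρXρ⁻¹ - X ∈ p·M_N(ℤ/p^mℤ)`, then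
`1 + p^{m-2}X` is invertible with inverse `1 - p^{m-2}X + p^{2m-4}X²`, and
`(1 + p^{m-2}X) ρ (1 + p^{m-2}X)⁻¹ = (1 + p^{m-2}(X - ρXρ⁻¹)) ρ`. -/
theorem conjugation_identity_mod_p_pow
    (p : ℕ) (hp : p.Prime) (m N : ℕ) (hm : 3 ≤ m) (hN : 1 ≤ N)
    (ρ : (Matrix (Fin N) (Fin N) (ZMod (p ^ m)))ˣ)
    (X : Matrix (Fin N) (Fin N) (ZMod (p ^ m)))
    (hX : ∃ Y : Matrix (Fin N) (Fin N) (ZMod (p ^ m)),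
      (ρ : Matrix (Fin N) (Fin N) (ZMod (p ^ m))) * X *
          ((ρ⁻¹ : (Matrix (Fin N) (Fin N) (ZMod (p ^ m)))ˣ) :
            Matrix (Fin N) (Fin N) (ZMod (p ^ m))) - X
        = (p : ZMod (p ^ m)) • Y) :
    (1 + (p : ZMod (p ^ m)) ^ (m - 2) • X) *
        (1 - (p : ZMod (p ^ m)) ^ (m - 2) • X +
          (p : ZMod (p ^ m)) ^ (2 * m - 4) • X ^ 2) = 1 ∧
    (1 - (p : ZMod (p ^ m)) ^ (m - 2) • X +
          (p : ZMod (p ^ m)) ^ (2 * m - 4) • X ^ 2) *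
        (1 + (p : ZMod (p ^ m)) ^ (m - 2) • X) = 1 ∧
    (1 + (p : ZMod (p ^ m)) ^ (m - 2) • X) *
        (ρ : Matrix (Fin N) (Fin N) (ZMod (p ^ m))) *
        (1 - (p : ZMod (p ^ m)) ^ (m - 2) • X +
          (p : ZMod (p ^ m)) ^ (2 * m - 4) • X ^ 2) =
      (1 + (p : ZMod (p ^ m)) ^ (m - 2) •
          (X - (ρ : Matrix (Fin N) (Fin N) (ZMod (p ^ m))) * X *
            ((ρ⁻¹ : (Matrix (Fin N) (Fin N) (ZMod (p ^ m)))ˣ) :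
              Matrix (Fin N) (Fin N) (ZMod (p ^ m))))) *
        (ρ : Matrix (Fin N) (Fin N) (ZMod (p ^ m))) := by
  have hzero {k : ℕ} (hk : m ≤ k) : (p : ZMod (p ^ m)) ^ k = 0 := by
    rw [← Nat.cast_pow, ZMod.natCast_eq_zero_iff]
    exact pow_dvd_pow p hk
  have ha : ((p : ZMod (p ^ m)) ^ (m - 2)) ^ 3 = 0 := by
    rw [← pow_mul]
    exact hzero (by omega)
  have hsq : (p : ZMod (p ^ m)) ^ (2 * m - 4) = (p ^ (m - 2)) ^ 2 := by
    rw [← pow_mul]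
    congr 1
    omega
  obtain ⟨Y, hY⟩ := hX
  have hconj : ((p : ZMod (p ^ m)) ^ (m - 2)) ^ 2 •
      ((ρ : Matrix (Fin N) (Fin N) (ZMod (p ^ m))) * X *
        ((ρ⁻¹ : (Matrix (Fin N) (Fin N) (ZMod (p ^ m)))ˣ) :
          Matrix (Fin N) (Fin N) (ZMod (p ^ m))) - X) = 0 := by
    rw [hY, smul_smul, ← pow_mul, ← pow_succ, hzero (by omega), zero_smul]
  rw [hsq]
  exact ⟨one_add_smul_mul_of_pow_three_eq_zero ha X, mul_one_add_smul_of_pow_three_eq_zero ha X,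
    one_add_smul_conj_unit ha ρ X hconj⟩
end

section
/- Let p be an odd prime, let n ≥ 2 be an integer, and let N ≥ 1. Let H be a subgroup of GL_N(ℤ/p^{n+1}ℤ) such that for every N×N matrix Z over ℤ/p^nℤ, the image of H under the reduction homomorphism GL_N(ℤ/p^{n+1}ℤ) → GL_N(ℤ/p^nℤ) contains the element 1 + p^{n-1}·Z. Then H contains every matrix of the form 1 + p^n·X with X an N×N matrix over ℤ/p^{n+1}ℤ; in particular H contains the kernel of the reduction GL_N(ℤ/p^{n+1}ℤ) → GL_N(ℤ/p^nℤ). -/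
theorem ZMod.exists_eq_mul_of_castHom_eq_zero {m k : ℕ} (h : k ∣ m) {x : ZMod m}
    (hx : ZMod.castHom h (ZMod k) x = 0) : ∃ w : ZMod m, x = (k : ZMod m) * w := by
  obtain ⟨a, rfl⟩ := ZMod.intCast_surjective x
  rw [map_intCast, ZMod.intCast_zmod_eq_zero_iff_dvd] at hx
  obtain ⟨b, rfl⟩ := hx
  exact ⟨b, by push_cast; rfl⟩

theorem Matrix.exists_eq_smul_of_mapMatrix_castHom_eq_zero {ι : Type*} [Fintype ι]
    [DecidableEq ι] {m k : ℕ} (h : k ∣ m) {M : Matrix ι ι (ZMod m)}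
    (hM : (ZMod.castHom h (ZMod k)).mapMatrix M = 0) :
    ∃ W : Matrix ι ι (ZMod m), M = (k : ZMod m) • W := by
  choose W hW using fun i j => ZMod.exists_eq_mul_of_castHom_eq_zero h
    (x := M i j) (congrFun (congrFun hM i) j)
  exact ⟨Matrix.of W, Matrix.ext hW⟩

theorem one_add_pow_of_pow_three_eq_zero {R : Type*} [Ring R] {a : R} (ha : a ^ 3 = 0) (m : ℕ) :
    (1 + a) ^ m = 1 + (m : R) * a + (m.choose 2 : R) * a ^ 2 := by
  induction m with
  | zero => simp
  | succ k ih =>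
    have ha' : a ^ 2 * a = 0 := by rw [← pow_succ, ha]
    rw [pow_succ, ih, Nat.choose_succ_succ' k 1, Nat.choose_one_right]
    push_cast
    simp only [mul_add, add_mul, mul_one, one_mul, mul_assoc, ha', mul_zero, ← pow_two]
    abel

theorem one_add_pow_prime_of_pow_three_eq_zero {R : Type*} [Ring R] {p : ℕ} (hp : p.Prime)
    (hp2 : p ≠ 2) {a : R} (ha : a ^ 3 = 0) (hpa : (p : R) * a ^ 2 = 0) :
    (1 + a) ^ p = 1 + (p : R) * a := by
  obtain ⟨c, hc⟩ := hp.dvd_choose_self two_ne_zero (lt_of_le_of_ne hp.two_le hp2.symm)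
  rw [one_add_pow_of_pow_three_eq_zero ha, hc, mul_comm p c]
  push_cast
  rw [mul_assoc, hpa, mul_zero, add_zero]

/-- The inductive step establishing that a subgroup of `GL_N(ℤ/p^{n+1}ℤ)` whose image mod
`p^n` contains all elements `1 + p^{n-1}Z` must itself contain every element of the form
`1 + p^nX`; in particular it contains the kernel of reduction mod `p^n`. -/
theorem subgroup_contains_congruence_kernel
    (p : ℕ) (hp : p.Prime) (hp2 : p ≠ 2) (n N : ℕ) (hn : 2 ≤ n) (hN : 1 ≤ N)
    (H : Subgroup ((Matrix (Fin N) (Fin N) (ZMod (p ^ (n + 1))))ˣ))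
    (hH : ∀ Z : Matrix (Fin N) (Fin N) (ZMod (p ^ n)),
      ∃ u ∈ H,
        ((ZMod.castHom (pow_dvd_pow p n.le_succ) (ZMod (p ^ n))).mapMatrix
            ((u : (Matrix (Fin N) (Fin N) (ZMod (p ^ (n + 1))))ˣ) :
              Matrix (Fin N) (Fin N) (ZMod (p ^ (n + 1)))))
          = 1 + (p : ZMod (p ^ n)) ^ (n - 1) • Z) :
    (∀ X : Matrix (Fin N) (Fin N) (ZMod (p ^ (n + 1))),
      ∃ u ∈ H,
        ((u : (Matrix (Fin N) (Fin N) (ZMod (p ^ (n + 1))))ˣ) :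
            Matrix (Fin N) (Fin N) (ZMod (p ^ (n + 1))))
          = 1 + (p : ZMod (p ^ (n + 1))) ^ n • X) ∧
    (∀ u : (Matrix (Fin N) (Fin N) (ZMod (p ^ (n + 1))))ˣ,
      (ZMod.castHom (pow_dvd_pow p n.le_succ) (ZMod (p ^ n))).mapMatrix
          ((u : (Matrix (Fin N) (Fin N) (ZMod (p ^ (n + 1))))ˣ) :
            Matrix (Fin N) (Fin N) (ZMod (p ^ (n + 1)))) = 1
        → u ∈ H) := by
  have hz : ∀ k, n + 1 ≤ k → (p : ZMod (p ^ (n + 1))) ^ k = 0 := fun k hk =>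
    pow_eq_zero_of_le hk (by exact_mod_cast ZMod.natCast_self (p ^ (n + 1)))
  have key : ∀ X : Matrix (Fin N) (Fin N) (ZMod (p ^ (n + 1))),
      ∃ u ∈ H, (u : Matrix (Fin N) (Fin N) (ZMod (p ^ (n + 1))))
        = 1 + (p : ZMod (p ^ (n + 1))) ^ n • X := by
    intro X
    obtain ⟨u, huH, hu⟩ :=
      hH ((ZMod.castHom (pow_dvd_pow p n.le_succ) (ZMod (p ^ n))).mapMatrix X)
    obtain ⟨W, hW⟩ := Matrix.exists_eq_smul_of_mapMatrix_castHom_eq_zero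
      (pow_dvd_pow p n.le_succ)
      (M := (u : Matrix (Fin N) (Fin N) (ZMod (p ^ (n + 1))))
        - (1 + (p : ZMod (p ^ (n + 1))) ^ (n - 1) • X)) (by
        rw [map_sub, hu, map_add, map_one, sub_eq_zero]
        congr 1
        ext i j
        simp only [RingHom.mapMatrix_apply, Matrix.smul_apply, Matrix.map_apply, smul_eq_mul,
          map_mul, map_pow, map_natCast])
    obtain ⟨m, rfl⟩ : ∃ m, n = m + 1 := ⟨n - 1, by omega⟩
    rw [Nat.add_sub_cancel] at hW
    have hu' : (u : Matrix (Fin N) (Fin N) (ZMod (p ^ (m + 1 + 1))))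
        = 1 + (p : ZMod (p ^ (m + 1 + 1))) ^ m • (X + (p : ZMod (p ^ (m + 1 + 1))) • W) := by
      rw [sub_eq_iff_eq_add] at hW
      rw [hW, smul_add, smul_smul, ← pow_succ]
      push_cast
      abel
    have hcast (A : Matrix (Fin N) (Fin N) (ZMod (p ^ (m + 1 + 1)))) :
        (p : Matrix (Fin N) (Fin N) (ZMod (p ^ (m + 1 + 1)))) * A
          = (p : ZMod (p ^ (m + 1 + 1))) • A := by
      rw [← nsmul_eq_mul, Nat.cast_smul_eq_nsmul]
    refine ⟨u ^ p, H.pow_mem huH p, ?_⟩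
    rw [Units.val_pow_eq_pow_val, hu', one_add_pow_prime_of_pow_three_eq_zero hp hp2, hcast,
      smul_smul, ← pow_succ', smul_add, smul_smul, ← pow_succ, hz (m + 1 + 1) le_rfl, zero_smul,
      add_zero]
    · rw [smul_pow, ← pow_mul, hz _ (by omega), zero_smul]
    · rw [smul_pow, hcast, smul_smul, ← pow_mul, ← pow_succ', hz _ (by omega), zero_smul]
  refine ⟨key, fun u hu => ?_⟩
  obtain ⟨W, hW⟩ := Matrix.exists_eq_smul_of_mapMatrix_castHom_eq_zero
    (pow_dvd_pow p n.le_succ)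
    (M := (u : Matrix (Fin N) (Fin N) (ZMod (p ^ (n + 1)))) - 1)
    (by rw [map_sub, hu, map_one, sub_self])
  obtain ⟨v, hvH, hv⟩ := key W
  have huv : u = v := Units.ext (by
    rw [hv, ← Nat.cast_pow, ← hW, add_sub_cancel])
  exact huv ▸ hvH
end
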